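/- Scarf's theorem, case (ii): if b > c, c+h > 0, μ > 0, σ > 0 and σ²/μ² < (b−c)/(h+c), then with κ = (b−h−2c)/(b+h), the unique minimizer over x ∈ ℝ of ψ(x) = sup_{Q ∈ M} E_Q[c·x + b·(D−x)₊ + h·(x−D)₊] is x* = μ + κσ(1−κ²)^{−1/2}, and the optimal value is c·μ + √((h+c)(b−c))·σ. -/

import Mathlib

open MeasureTheory Set

/-- Membership in the moment family: probability measures on ℝ₊ with mean μ
and second moment μ²+σ². -/
def inMomentFamily (μ σ : ℝ) (Q : MeasureTheory.Measure ℝ) : Prop :=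
  MeasureTheory.IsProbabilityMeasure Q ∧ Q (Set.Ici (0:ℝ))ᶜ = 0 ∧
    MeasureTheory.Integrable id Q ∧ MeasureTheory.Integrable (fun t => t ^ 2) Q ∧
    (∫ t, t ∂Q) = μ ∧ (∫ t, t ^ 2 ∂Q) = μ ^ 2 + σ ^ 2

/-- Scarf's worst-case cost ψ(x). -/
noncomputable def scarfPsi (c b h μ σ : ℝ) (x : ℝ) : ℝ :=
  sSup ((fun Q : MeasureTheory.Measure ℝ =>
    ∫ d, c * x + b * max (d - x) 0 + h * max (x - d) 0 ∂Q) ''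
      {Q | inMomentFamily μ σ Q})

theorem newsvendorCost_le_quadratic (b c h x r d : ℝ) (hbh : 0 < b + h) (hr : 0 < r) :
    c * x + b * max (d - x) 0 + h * max (x - d) 0 ≤
      c * x + (b - h) / 2 * (d - x) + (b + h) / 4 * ((d - x) ^ 2 / r + r) := by
  have key : ∀ u : ℝ, 2 * u ≤ u ^ 2 / r + r := fun u => by
    rw [← sub_nonneg]
    have : u ^ 2 / r + r - 2 * u = (u - r) ^ 2 / r := by field_simp; ring
    rw [this]; positivity
  rcases le_total x d with hd | hd
  · rw [max_eq_left (sub_nonneg.2 hd), max_eq_right (sub_nonpos.2 hd)]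
    nlinarith [mul_le_mul_of_nonneg_left (key (d - x)) hbh.le]
  · rw [max_eq_right (sub_nonpos.2 hd), max_eq_left (sub_nonneg.2 hd)]
    have := key (x - d)
    rw [sub_sq_comm] at this
    nlinarith [mul_le_mul_of_nonneg_left this hbh.le]

theorem le_newsvendorCost_above (b c h x d : ℝ) (hbh : 0 < b + h) :
    c * x + b * (d - x) ≤ c * x + b * max (d - x) 0 + h * max (x - d) 0 := by
  rcases le_total x d with hd | hd
  · rw [max_eq_left (sub_nonneg.2 hd), max_eq_right (sub_nonpos.2 hd)]; linarith
  · rw [max_eq_right (sub_nonpos.2 hd), max_eq_left (sub_nonneg.2 hd)]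
    nlinarith [mul_nonneg hbh.le (sub_nonneg.2 hd)]

theorem le_newsvendorCost_below (b c h x d : ℝ) (hbh : 0 < b + h) :
    c * x + h * (x - d) ≤ c * x + b * max (d - x) 0 + h * max (x - d) 0 := by
  rcases le_total x d with hd | hd
  · rw [max_eq_left (sub_nonneg.2 hd), max_eq_right (sub_nonpos.2 hd)]
    nlinarith [mul_nonneg hbh.le (sub_nonneg.2 hd)]
  · rw [max_eq_right (sub_nonpos.2 hd), max_eq_left (sub_nonneg.2 hd)]; linarith

theorem integral_newsvendorCost_le {b c h μ σ x r : ℝ} (hbh : 0 < b + h) (hr : 0 < r)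
    {Q : Measure ℝ} (hQ : inMomentFamily μ σ Q) :
    ∫ d, c * x + b * max (d - x) 0 + h * max (x - d) 0 ∂Q ≤
      c * x + (b - h) / 2 * (μ - x) + (b + h) / 4 * (((μ - x) ^ 2 + σ ^ 2) / r + r) := by
  obtain ⟨hprob, -, h1, h2, hm1, hm2⟩ := hQ
  have h1' : Integrable (fun d : ℝ => d) Q := h1
  set k := (b + h) / 4 with hk
  set C := c * x - (b - h) / 2 * x + k * (x ^ 2 / r + r) with hC
  set B := (b - h) / 2 - 2 * k * x / r with hB
  have hlin : Integrable (fun d : ℝ => C + B * d) Q :=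
    (integrable_const C).add (h1'.const_mul B)
  have hquad : Integrable (fun d : ℝ => C + B * d + k / r * d ^ 2) Q :=
    hlin.add (h2.const_mul (k / r))
  have hval : ∫ d, C + B * d + k / r * d ^ 2 ∂Q = C + B * μ + k / r * (μ ^ 2 + σ ^ 2) := by
    rw [integral_add hlin (h2.const_mul (k / r)),
      integral_add (integrable_const C) (h1'.const_mul B), integral_const_mul,
      integral_const_mul, hm1, hm2]
    simp
  have hcost : Integrable (fun d => c * x + b * max (d - x) 0 + h * max (x - d) 0) Q :=
    ((integrable_const _).add ((h1'.sub (integrable_const x)).pos_part.const_mul b)).add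
      (((integrable_const x).sub h1').pos_part.const_mul h)
  calc _ ≤ ∫ d, C + B * d + k / r * d ^ 2 ∂Q := by
        refine integral_mono hcost hquad fun d => ?_
        refine (newsvendorCost_le_quadratic b c h x r d hbh hr).trans_eq ?_
        simp only [hC, hB, ← hk]
        field_simp
        ring
    _ = _ := by
        rw [hval]
        simp only [hC, hB]
        field_simp
        ring

theorem bddAbove_newsvendorCost {b c h : ℝ} (μ σ x : ℝ) (hbh : 0 < b + h) :
    BddAbove ((fun Q : Measure ℝ => ∫ d, c * x + b * max (d - x) 0 + h * max (x - d) 0 ∂Q) ''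
      {Q | inMomentFamily μ σ Q}) :=
  ⟨_, by rintro _ ⟨Q, hQ, rfl⟩; exact integral_newsvendorCost_le hbh one_pos hQ⟩

/-- The probability measure with mass `p` at `u` and mass `1 - p` at `v`. -/
noncomputable def twoPointMeasure (p u v : ℝ) : Measure ℝ :=
  ENNReal.ofReal p • Measure.dirac u + ENNReal.ofReal (1 - p) • Measure.dirac v

theorem integrable_twoPointMeasure (p u v : ℝ) (f : ℝ → ℝ) :
    Integrable f (twoPointMeasure p u v) :=
  ((integrable_dirac (by simp)).smul_measure ENNReal.ofReal_ne_top).add_measure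
    ((integrable_dirac (by simp)).smul_measure ENNReal.ofReal_ne_top)

theorem integral_twoPointMeasure {p : ℝ} (hp0 : 0 ≤ p) (hp1 : p ≤ 1) (u v : ℝ) (f : ℝ → ℝ) :
    ∫ d, f d ∂twoPointMeasure p u v = p * f u + (1 - p) * f v := by
  rw [twoPointMeasure, integral_add_measure
      ((integrable_dirac (by simp)).smul_measure ENNReal.ofReal_ne_top)
      ((integrable_dirac (by simp)).smul_measure ENNReal.ofReal_ne_top),
    integral_smul_measure, integral_smul_measure, integral_dirac, integral_dirac,
    ENNReal.toReal_ofReal hp0, ENNReal.toReal_ofReal (sub_nonneg.2 hp1)]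
  simp

theorem inMomentFamily_twoPointMeasure {μ σ τ : ℝ} (hμ : 0 < μ) (hσ : 0 < σ) (hτ : 0 < τ)
    (hlow : σ ≤ μ * τ) :
    inMomentFamily μ σ (twoPointMeasure (1 / (1 + τ ^ 2)) (μ + σ * τ) (μ - σ / τ)) := by
  have hp0 : 0 ≤ 1 / (1 + τ ^ 2) := by positivity
  have hp1 : 1 / (1 + τ ^ 2) ≤ 1 := by
    rw [div_le_one (by positivity)]; nlinarith [sq_nonneg τ]
  have hu : 0 ≤ μ + σ * τ := by positivity
  have hv : σ / τ ≤ μ := by rwa [div_le_iff₀ hτ]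
  refine ⟨⟨?_⟩, ?_, integrable_twoPointMeasure _ _ _ _, integrable_twoPointMeasure _ _ _ _, ?_, ?_⟩
  · simp only [twoPointMeasure, Measure.add_apply, Measure.smul_apply, measure_univ, smul_eq_mul,
      mul_one]
    rw [← ENNReal.ofReal_add hp0 (sub_nonneg.2 hp1)]
    simp
  · simp [twoPointMeasure, hu, hv]
  · rw [integral_twoPointMeasure hp0 hp1]
    field_simp
    ring
  · rw [integral_twoPointMeasure hp0 hp1 _ _ (fun t => t ^ 2)]
    field_simp
    ring

theorem le_scarfPsi_of_twoPoint {b c h μ σ τ : ℝ} (hbh : 0 < b + h) (hμ : 0 < μ) (hσ : 0 < σ)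
    (hτ : 0 < τ) (hlow : σ ≤ μ * τ) (x : ℝ) :
    c * x + (b * (μ + σ * τ - x) + τ ^ 2 * (h * (x - (μ - σ / τ)))) / (1 + τ ^ 2) ≤
      scarfPsi c b h μ σ x := by
  have hp0 : 0 ≤ 1 / (1 + τ ^ 2) := by positivity
  have hp1 : 1 / (1 + τ ^ 2) ≤ 1 := by
    rw [div_le_one (by positivity)]; nlinarith [sq_nonneg τ]
  refine le_trans ?_ (le_csSup (bddAbove_newsvendorCost μ σ x hbh)
    ⟨_, inMomentFamily_twoPointMeasure hμ hσ hτ hlow, rfl⟩)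
  simp only
  rw [integral_twoPointMeasure hp0 hp1 _ _
    (fun d => c * x + b * max (d - x) 0 + h * max (x - d) 0)]
  refine le_trans (le_of_eq ?_) (add_le_add
    (mul_le_mul_of_nonneg_left (le_newsvendorCost_above b c h x (μ + σ * τ) hbh) hp0)
    (mul_le_mul_of_nonneg_left (le_newsvendorCost_below b c h x (μ - σ / τ) hbh)
      (sub_nonneg.2 hp1)))
  field_simp
  ring

theorem twoPoint_bound_eq {b c h μ σ s x τ τ₀ : ℝ} (hτ : 0 < τ) (hs : s = (h + c) * τ₀)
    (hτ₀ : b - c = (h + c) * τ₀ ^ 2) :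
    c * x + (b * (μ + σ * τ - x) + τ ^ 2 * (h * (x - (μ - σ / τ)))) / (1 + τ ^ 2) =
      c * μ + s * σ + (τ - τ₀) * (2 * s * (x - μ) - (b - h - 2 * c) * σ
        + ((h + c) * (x - μ) - s * σ) * (τ - τ₀)) / (1 + τ ^ 2) := by
  obtain rfl : b = c + (h + c) * τ₀ ^ 2 := by linarith
  subst hs
  field_simp
  ring

/-- Scarf's theorem, case (ii): if σ²/μ² < (b−c)/(h+c) then, with
κ = (b−h−2c)/(b+h), the unique minimizer of ψ over ℝ is
x* = μ + κσ(1−κ²)^{−1/2}, with optimal value cμ + √((h+c)(b−c))σ. -/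
theorem scarf_case_ii (b c h μ σ : ℝ) (hbc : c < b) (hch : 0 < c + h)
    (hμ : 0 < μ) (hσ : 0 < σ) (hvar : σ ^ 2 / μ ^ 2 < (b - c) / (h + c)) :
    let κ := (b - h - 2 * c) / (b + h)
    let xstar := μ + κ * σ / Real.sqrt (1 - κ ^ 2)
    scarfPsi c b h μ σ xstar = c * μ + Real.sqrt ((h + c) * (b - c)) * σ ∧
    ∀ x : ℝ, x ≠ xstar → scarfPsi c b h μ σ xstar < scarfPsi c b h μ σ x := by
  intro κ xstar
  have hbh : 0 < b + h := by linarith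
  have hγ : 0 < h + c := by linarith
  have hβ : 0 < b - c := by linarith
  set s := Real.sqrt ((h + c) * (b - c)) with hs
  have hspos : 0 < s := Real.sqrt_pos.2 (mul_pos hγ hβ)
  have hssq : s ^ 2 = (h + c) * (b - c) := Real.sq_sqrt (mul_pos hγ hβ).le
  have hsqrt : Real.sqrt (1 - κ ^ 2) = 2 * s / (b + h) := by
    rw [show 1 - κ ^ 2 = (2 * s / (b + h)) ^ 2 by
      rw [div_pow (2 * s), mul_pow, hssq]; simp only [κ]; field_simp; ring]
    exact Real.sqrt_sq (by positivity)
  have hxstar : xstar = μ + (b - h - 2 * c) * σ / (2 * s) := by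
    simp only [xstar, hsqrt, κ]
    field_simp
  set τ₀ := s / (h + c) with hτ₀def
  have hτ₀ : 0 < τ₀ := by positivity
  have hsτ : s = (h + c) * τ₀ := by rw [hτ₀def]; field_simp
  have hβτ : b - c = (h + c) * τ₀ ^ 2 := by
    rw [hτ₀def, div_pow, hssq]; field_simp
  have hlow : σ / μ < τ₀ := by
    refine lt_of_pow_lt_pow_left₀ 2 hτ₀.le ?_
    rw [div_pow]
    refine hvar.trans_eq ?_
    rw [hβτ]; field_simp
  have hlower : c * μ + s * σ ≤ scarfPsi c b h μ σ xstar := by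
    refine le_trans (le_of_eq ?_) (le_scarfPsi_of_twoPoint hbh hμ hσ hτ₀
      ((div_le_iff₀' hμ).1 hlow.le) xstar)
    rw [twoPoint_bound_eq hτ₀ hsτ hβτ]
    simp
  have hupper : scarfPsi c b h μ σ xstar ≤ c * μ + s * σ := by
    refine csSup_le ⟨_, _, inMomentFamily_twoPointMeasure hμ hσ hτ₀
      ((div_le_iff₀' hμ).1 hlow.le), rfl⟩ ?_
    rintro _ ⟨Q, hQ, rfl⟩
    refine (integral_newsvendorCost_le hbh (r := σ * (b + h) / (2 * s)) (by positivity)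
      hQ).trans_eq ?_
    rw [hxstar]
    have hb : b = c + (h + c) * τ₀ ^ 2 := by linarith
    have hbh' : b + h = (h + c) * (1 + τ₀ ^ 2) := by linarith
    rw [hbh', hsτ, hb]
    field_simp
    ring
  have hopt := le_antisymm hupper hlower
  refine ⟨hopt, fun x hx => ?_⟩
  rw [hopt]
  set δ := x - xstar with hδ
  have hδ0 : δ ≠ 0 := sub_ne_zero.2 hx
  set A := (h + c) * (x - μ) - s * σ with hA
  obtain ⟨ε, hε, hτlow, hεA⟩ : ∃ ε : ℝ, 0 < ε ∧ σ / μ < τ₀ + ε * δ ∧ 0 < 2 * s + A * ε := by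
    have h1 : ∀ᶠ ε in nhds (0 : ℝ), σ / μ < τ₀ + ε * δ :=
      ((by fun_prop : Continuous fun ε : ℝ => τ₀ + ε * δ).tendsto' 0 τ₀
        (by simp)).eventually_const_lt hlow
    have h2 : ∀ᶠ ε in nhds (0 : ℝ), 0 < 2 * s + A * ε :=
      ((by fun_prop : Continuous fun ε : ℝ => 2 * s + A * ε).tendsto' 0 (2 * s)
        (by simp)).eventually_const_lt (by positivity)
    obtain ⟨ε, ⟨h1, h2⟩, hε⟩ :=
      (((h1.and h2).filter_mono nhdsWithin_le_nhds).and
        (self_mem_nhdsWithin (s := Ioi (0 : ℝ)))).exists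
    exact ⟨ε, hε, h1, h2⟩
  have hτ : 0 < τ₀ + ε * δ := (div_pos hσ hμ).trans hτlow
  refine lt_of_lt_of_le ?_ (le_scarfPsi_of_twoPoint hbh hμ hσ hτ
    ((div_le_iff₀' hμ).1 hτlow.le) x)
  rw [twoPoint_bound_eq hτ hsτ hβτ, ← hA]
  refine lt_add_of_pos_right _ (div_pos ?_ (by positivity))
  have hslope : 2 * s * (x - μ) - (b - h - 2 * c) * σ = 2 * s * δ := by
    rw [hδ, hxstar]; field_simp; ring
  rw [hslope, show (τ₀ + ε * δ - τ₀) * (2 * s * δ + A * (τ₀ + ε * δ - τ₀)) =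
    ε * δ ^ 2 * (2 * s + A * ε) by ring]
  positivity
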